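/- Equation (17) (Psi=p/q) in the proof of Proposition A.1: Let x_1, ..., x_l in R^k (l <= k) be linearly independent, let c be a nonzero vector in span(x_1, ..., x_l), set M = (1/l) * sum_{i=1}^l x_i x_i^T, fix d with M d = c, and define p_i* = |x_i^T d| / sum_j |x_j^T d| and gamma = l / sum_j |x_j^T d|. Let p_1, ..., p_l be any weights (p_i >= 0, sum_i p_i = 1) such that c is estimable under xi = {(x_i, p_i)}, and let d_xi satisfy M(xi) d_xi = c. Then Psi(xi) = sum_{i=1}^l p_i * (x_i^T d_xi)^2 = gamma^{-2} * sum over those i with p_i > 0 of (p_i*)^2 / p_i. -/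

import Mathlib

open Matrix BigOperators

/-- The information matrix of a design with points `x i` and weights `p i`. -/
noncomputable def infoMat {k l : ℕ} (x : Fin l → Fin k → ℝ) (p : Fin l → ℝ) :
    Matrix (Fin k) (Fin k) ℝ :=
  ∑ i, p i • vecMulVec (x i) (x i)

/-- The optimal weight `p_i* = |x_iᵀ d| / ∑ j |x_jᵀ d|`, where `d` solves `M d = c`. -/
noncomputable def pStar {k l : ℕ} (x : Fin l → Fin k → ℝ) (d : Fin k → ℝ) (i : Fin l) : ℝ :=
  |x i ⬝ᵥ d| / ∑ j, |x j ⬝ᵥ d|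

theorem infoMat_mulVec {k l : ℕ} (x : Fin l → Fin k → ℝ) (p : Fin l → ℝ) (v : Fin k → ℝ) :
    infoMat x p *ᵥ v = ∑ i, (p i * (x i ⬝ᵥ v)) • x i := by
  simp only [infoMat, sum_mulVec, smul_mulVec, vecMulVec_mulVec, op_smul_eq_smul, smul_smul]

theorem infoMat_mulVec_dotProduct {k l : ℕ} (x : Fin l → Fin k → ℝ) (p : Fin l → ℝ)
    (v : Fin k → ℝ) :
    (infoMat x p *ᵥ v) ⬝ᵥ v = ∑ i, p i * (x i ⬝ᵥ v) ^ 2 := by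
  simp only [infoMat_mulVec, sum_dotProduct, smul_dotProduct, smul_eq_mul, pow_two, mul_assoc]

theorem infoMat_mulVec_eq_iff {k l : ℕ} {x : Fin l → Fin k → ℝ}
    (hx : LinearIndependent ℝ x) {p q : Fin l → ℝ} {v w : Fin k → ℝ} :
    infoMat x p *ᵥ v = infoMat x q *ᵥ w ↔ ∀ i, p i * (x i ⬝ᵥ v) = q i * (x i ⬝ᵥ w) := by
  rw [infoMat_mulVec, infoMat_mulVec]
  refine ⟨fun h => ?_, fun h => Finset.sum_congr rfl fun i _ => by rw [h i]⟩
  have h0 : ∑ i, (p i * (x i ⬝ᵥ v) - q i * (x i ⬝ᵥ w)) • x i = 0 := by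
    simp only [sub_smul, Finset.sum_sub_distrib, h, sub_self]
  exact fun i => sub_eq_zero.mp (Fintype.linearIndependent_iff.mp hx _ h0 i)

/-- Equation (17) in the proof of Proposition A.1: for any weights `p`
making `c` estimable under `ξ = {(x_i, p_i)}` and any `d_ξ` with `M(ξ) d_ξ = c`, the
criterion value satisfies
`Ψ(ξ) = cᵀ d_ξ = ∑ i p_i (x_iᵀ d_ξ)² = γ⁻² ∑_{i : p_i > 0} (p_i*)² / p_i`. -/
theorem eq17_Psi {k l : ℕ} (hk : 1 ≤ k) (hl : l ≤ k)
    (x : Fin l → Fin k → ℝ) (hxLI : LinearIndependent ℝ x)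
    (c : Fin k → ℝ) (hc : c ≠ 0) (hcspan : c ∈ Submodule.span ℝ (Set.range x))
    (M : Matrix (Fin k) (Fin k) ℝ) (hM : M = (l : ℝ)⁻¹ • ∑ i, vecMulVec (x i) (x i))
    (d : Fin k → ℝ) (hd : M *ᵥ d = c)
    (γ : ℝ) (hγ : γ = (l : ℝ) / ∑ j, |x j ⬝ᵥ d|)
    (p : Fin l → ℝ) (hp : ∀ i, 0 ≤ p i) (hpsum : ∑ i, p i = 1)
    (dξ : Fin k → ℝ) (hdξ : (infoMat x p) *ᵥ dξ = c) :
    c ⬝ᵥ dξ = ∑ i, p i * (x i ⬝ᵥ dξ) ^ 2 ∧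
    c ⬝ᵥ dξ = γ⁻¹ ^ 2 * ∑ i ∈ Finset.univ.filter (fun i => 0 < p i),
      (pStar x d i) ^ 2 / p i := by
  have hM' : M = infoMat x fun _ => (l : ℝ)⁻¹ := by rw [hM, infoMat, Finset.smul_sum]
  have hcoeff : ∀ i, p i * (x i ⬝ᵥ dξ) = (l : ℝ)⁻¹ * (x i ⬝ᵥ d) :=
    (infoMat_mulVec_eq_iff hxLI).mp (by rw [hdξ, ← hd, hM'])
  have hS : ∑ j, |x j ⬝ᵥ d| ≠ 0 := by
    intro h
    have hz : ∀ j, x j ⬝ᵥ d = 0 := fun j => abs_eq_zero.mp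
      ((Finset.sum_eq_zero_iff_of_nonneg fun j _ => abs_nonneg _).mp h j (Finset.mem_univ j))
    apply hc
    rw [← hd, hM', infoMat_mulVec]
    simp [hz]
  have hΨ : c ⬝ᵥ dξ = ∑ i, p i * (x i ⬝ᵥ dξ) ^ 2 := by
    rw [← infoMat_mulVec_dotProduct, hdξ]
  refine ⟨hΨ, ?_⟩
  rw [hΨ, Finset.mul_sum, Finset.sum_filter]
  refine Finset.sum_congr rfl fun i _ => ?_
  split_ifs with hi
  · calc p i * (x i ⬝ᵥ dξ) ^ 2 = (p i * (x i ⬝ᵥ dξ)) ^ 2 / p i := by field_simp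
      _ = γ⁻¹ ^ 2 * (pStar x d i ^ 2 / p i) := by
        rw [hcoeff, hγ, pStar, inv_div, div_pow |x i ⬝ᵥ d|, sq_abs]
        field_simp
  · rw [(not_lt.mp hi).antisymm (hp i), zero_mul]
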